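/- arXiv:2103.05134 — 4 statements merged into one kernel-verified Lean document; each statement's English description precedes it below -/
import Mathlib

section
/- Suppose Y is finite, for each i = 0,…,m and each y ∈ Y the conditional distribution of x given y under D_i is non-atomic, and H̄ is nonempty and decomposable. Then the cost-constraints epigraph set C = {(s_0, s) ∈ ℝ^{m+1} : there exists φ ∈ H̄ with E_{(x,y)~D_0}[ℓ_0(φ(x),y)] ≤ s_0 and E_{(x,y)~D_i}[ℓ_i(φ(x),y)] ≤ s_i for i = 1,…,m} is a nonempty convex set. -/
open MeasureTheory Finset
open scoped Classical

namespace CSL4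

/-- Expected loss `E_{(x,y)~D}[ℓ(φ(x),y)]`. -/
noncomputable def expLoss (d k : ℕ) (D : Measure ((Fin d → ℝ) × ℝ))
    (ℓ : (Fin k → ℝ) → ℝ → ℝ) (φ : (Fin d → ℝ) → Fin k → ℝ) : ℝ :=
  ∫ q, ℓ (φ q.1) q.2 ∂D

/-- A measure is non-atomic: every measurable set of positive measure contains a
measurable subset of strictly smaller positive measure. -/
def Nonatomic {α : Type*} [MeasurableSpace α] (ν : Measure α) : Prop :=
  ∀ s : Set α, MeasurableSet s → 0 < ν s →
    ∃ t, t ⊆ s ∧ MeasurableSet t ∧ 0 < ν t ∧ ν t < ν s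

lemma half_single {α : Type*} [MeasurableSpace α] [StandardBorelSpace α]
    (μ : Measure α) [IsFiniteMeasure μ] [NullSingletonClass μ] (A : Set α)
    (hA : MeasurableSet A) :
    ∃ H ⊆ A, MeasurableSet H ∧ μ.real H = μ.real A / 2 := by
  let g : α → ℝ := fun x => Real.sigmoid (embeddingReal α x)
  have he := measurableEmbedding_embeddingReal α
  have hg : Measurable g := Real.sigmoid_strictMono.monotone.measurable.comp he.measurable
  have hinj : Function.Injective g := Real.sigmoid_strictMono.injective.comp he.injective
  let ν := (μ.restrict A).map g
  haveI : IsFiniteMeasure ν := by dsimp [ν]; infer_instance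
  have hν : NullSingletonClass ν := by
    constructor
    intro x
    rw [Measure.map_apply hg (measurableSet_singleton x)]
    exact (Set.subsingleton_singleton.preimage hinj).measure_zero _
  have hval : ∀ t, 0 ≤ t → ∫ _x in (0:ℝ)..t, (1:ℝ) ∂ν = μ.real (A ∩ g ⁻¹' Set.Ioc 0 t) := by
    intro t ht
    rw [intervalIntegral.integral_of_le ht]
    simp only [integral_const, smul_eq_mul, mul_one, measureReal_restrict_apply MeasurableSet.univ,
      Set.univ_inter]
    simp only [ν, measureReal_def]
    rw [Measure.map_apply hg measurableSet_Ioc, Measure.restrict_apply (hg measurableSet_Ioc),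
      Set.inter_comm]
  have hc : Continuous fun b => ∫ _x in (0:ℝ)..b, (1:ℝ) ∂ν :=
    (integrable_const (1:ℝ)).continuous_primitive 0
  have h1 : A ∩ g ⁻¹' Set.Ioc 0 1 = A := by
    apply Set.inter_eq_left.2
    intro x _
    exact ⟨Real.sigmoid_pos _, Real.sigmoid_le_one _⟩
  have hivt := intermediate_value_Icc (zero_le_one (α := ℝ)) hc.continuousOn
  have hmem : μ.real A / 2 ∈ Set.Icc (∫ _x in (0:ℝ)..0, (1:ℝ) ∂ν) (∫ _x in (0:ℝ)..1, (1:ℝ) ∂ν) := by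
    rw [hval 0 le_rfl, hval 1 zero_le_one, h1]
    have : 0 ≤ μ.real A := measureReal_nonneg
    simp
    linarith
  obtain ⟨t, ht, hh⟩ := hivt hmem
  refine ⟨A ∩ g ⁻¹' Set.Ioc 0 t, Set.inter_subset_left, hA.inter (hg measurableSet_Ioc), ?_⟩
  rw [← hval t ht.1]
  exact hh

/-- Dyadic chain. -/
def chain {α : Type*} (A : Set α) (h : Set α → Set α) : ℕ → ℕ → Set α
  | 0, i => if i = 0 then ∅ else A
  | k+1, i => if i % 2 = 0 then chain A h k (i / 2)
      else chain A h k (i / 2) ∪ h (chain A h k (i / 2 + 1) \ chain A h k (i / 2))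

lemma path_of_half {α : Type*} [MeasurableSpace α] (T : Set (Measure α))
    (hT : ∀ ν ∈ T, IsFiniteMeasure ν)
    (hh : ∀ A, MeasurableSet A → ∃ H ⊆ A, MeasurableSet H ∧ ∀ ν ∈ T, ν.real H = ν.real A / 2)
    (A : Set α) (hA : MeasurableSet A) :
    ∃ Z : ℝ → Set α, Monotone Z ∧ (∀ t, MeasurableSet (Z t)) ∧ (∀ t, Z t ⊆ A) ∧
      ∀ t, 0 ≤ t → t ≤ 1 → ∀ ν ∈ T, ν.real (Z t) = t * ν.real A := by
  choose! h hsub hmeas hhalf using hh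
  let S := chain A h
  have h0 : ∀ i, S 0 i = if i = 0 then ∅ else A := fun i => rfl
  have hev : ∀ k i, S (k+1) (2*i) = S k i := by
    intro k i
    simp [S, chain]
  have hod : ∀ k i, S (k+1) (2*i+1) = S k i ∪ h (S k (i+1) \ S k i) := by
    intro k i
    have e1 : (2*i+1) % 2 = 1 := by omega
    have e2 : (2*i+1) / 2 = i := by omega
    simp [S, chain, e1, e2]
  have hSm : ∀ k i, MeasurableSet (S k i) := by
    intro k
    induction k with
    | zero => intro i; rw [h0]; split_ifs; exacts [MeasurableSet.empty, hA]
    | succ k ih =>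
      intro i
      obtain ⟨j, rfl | rfl⟩ := Nat.even_or_odd' i
      · rw [hev]; exact ih j
      · rw [hod]; exact (ih j).union (hmeas _ ((ih _).diff (ih _)))
  have hmono1 : ∀ k i, S k i ⊆ S k (i+1) := by
    intro k
    induction k with
    | zero => intro i; rw [h0, h0]; split_ifs <;> simp_all
    | succ k ih =>
      intro i
      obtain ⟨j, rfl | rfl⟩ := Nat.even_or_odd' i
      · rw [hev, hod]; exact Set.subset_union_left
      · rw [hod, show 2*j+1+1 = 2*(j+1) by ring, hev]
        exact Set.union_subset (ih j)
          ((hsub _ ((hSm _ _).diff (hSm _ _))).trans Set.diff_subset)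
  have hmono : ∀ k, Monotone (S k) := fun k => monotone_nat_of_le_succ (hmono1 k)
  have hSA : ∀ k i, S k i ⊆ A := by
    intro k
    induction k with
    | zero => intro i; rw [h0]; split_ifs <;> simp
    | succ k ih =>
      intro i
      obtain ⟨j, rfl | rfl⟩ := Nat.even_or_odd' i
      · rw [hev]; exact ih j
      · rw [hod]; exact Set.union_subset (ih j)
          ((hsub _ ((hSm _ _).diff (hSm _ _))).trans (Set.diff_subset.trans (ih _)))
  have hval : ∀ ν ∈ T, ∀ k i, i ≤ 2^k → ν.real (S k i) = (i : ℝ) / 2^k * ν.real A := by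
    intro ν hν k
    haveI := hT ν hν
    induction k with
    | zero =>
      intro i hi
      have : i = 0 ∨ i = 1 := by simp at hi; omega
      rcases this with rfl | rfl <;> simp [h0]
    | succ k ih =>
      intro i hi
      rw [pow_succ] at hi
      obtain ⟨j, rfl | rfl⟩ := Nat.even_or_odd' i
      · rw [hev, ih j (by omega)]; push_cast; field_simp; ring
      · have hd : MeasurableSet (S k (j+1) \ S k j) := (hSm _ _).diff (hSm _ _)
        rw [hod, measureReal_union (Set.disjoint_sdiff_right.mono_right (hsub _ hd)) (hmeas _ hd),
          hhalf _ hd ν hν, measureReal_diff (hmono1 k j) (hSm _ _), ih j (by omega),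
          ih (j+1) (by omega)]
        push_cast; field_simp; ring
  refine ⟨fun t => ⋃ k, S k ⌊t * 2^k⌋₊, ?_, ?_, ?_, ?_⟩
  · intro s t hst
    exact Set.iUnion_mono fun k => hmono k (Nat.floor_mono (by gcongr))
  · exact fun t => MeasurableSet.iUnion fun k => hSm _ _
  · exact fun t => Set.iUnion_subset fun k => hSA _ _
  · intro t ht0 ht1 ν hν
    haveI := hT ν hν
    have hm : Monotone fun k => S k ⌊t * 2^k⌋₊ := by
      apply monotone_nat_of_le_succ
      intro k
      rw [← hev k]
      apply hmono
      apply Nat.le_floor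
      push_cast
      have := Nat.floor_le (show 0 ≤ t * 2^k by positivity)
      rw [pow_succ]; linarith
    have hlim := (ENNReal.tendsto_toReal (measure_ne_top ν _)).comp
      (tendsto_measure_iUnion_atTop (μ := ν) hm)
    have hlim2 : Filter.Tendsto (fun k : ℕ => ((⌊t * 2^k⌋₊ : ℕ) : ℝ) / 2^k * ν.real A) Filter.atTop
        (nhds (t * ν.real A)) := by
      refine Filter.Tendsto.mul_const _ ?_
      exact (tendsto_nat_floor_mul_div_atTop (R := ℝ) ht0).comp
        (tendsto_pow_atTop_atTop_of_one_lt (one_lt_two))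
    refine tendsto_nhds_unique hlim (hlim2.congr fun k => ?_)
    rw [← hval ν hν k _ ?_]
    · rfl
    · have : t * 2^k ≤ ((2^k : ℕ) : ℝ) := by
        push_cast
        have : (0:ℝ) < 2^k := by positivity
        nlinarith
      exact Nat.floor_le_of_le this

lemma half_many {α : Type*} [MeasurableSpace α] [StandardBorelSpace α]
    (μ : Measure α) [IsFiniteMeasure μ] [NullSingletonClass μ] (T : Set (Measure α))
    (hTf : T.Finite) :
    (∀ ν ∈ T, ν ≤ μ) → ∀ A, MeasurableSet A →
    ∃ H ⊆ A, MeasurableSet H ∧ ∀ ν ∈ insert μ T, ν.real H = ν.real A / 2 := by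
  induction T, hTf using Set.Finite.induction_on with
  | empty =>
    intro _ A hA
    obtain ⟨H, h1, h2, h3⟩ := half_single μ A hA
    exact ⟨H, h1, h2, by simpa using h3⟩
  | @insert ρ T _ _ ih =>
    intro hle A hA
    have hfin : ∀ ν ∈ insert μ T, IsFiniteMeasure ν := by
      rintro ν (rfl | hν)
      · infer_instance
      · exact isFiniteMeasure_of_le μ (hle ν (Set.mem_insert_of_mem _ hν))
    have hρ : ρ ≤ μ := hle ρ (Set.mem_insert _ _)
    haveI : IsFiniteMeasure ρ := isFiniteMeasure_of_le μ hρ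
    obtain ⟨Z, hZm, hZmeas, hZA, hZ⟩ := path_of_half (insert μ T) hfin
      (ih fun ν hν => hle ν (Set.mem_insert_of_mem _ hν)) A hA
    have hZ0 : ρ.real (Z 0) = 0 := by
      have h1 := hZ 0 le_rfl zero_le_one μ (Set.mem_insert _ _)
      have : ρ.real (Z 0) ≤ μ.real (Z 0) := ENNReal.toReal_mono (measure_ne_top _ _) (hρ _)
      have h2 : 0 ≤ ρ.real (Z 0) := measureReal_nonneg
      linarith
    have hZ1 : ρ.real (Z 1) = ρ.real A := by
      have h1 := hZ 1 zero_le_one le_rfl μ (Set.mem_insert _ _)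
      have : ρ.real (A \ Z 1) ≤ μ.real (A \ Z 1) := ENNReal.toReal_mono (measure_ne_top _ _) (hρ _)
      rw [measureReal_diff (hZA 1) (hZmeas 1), measureReal_diff (hZA 1) (hZmeas 1)] at this
      have h2 : ρ.real (Z 1) ≤ ρ.real A := measureReal_mono (hZA 1)
      linarith
    have hlip : ∀ s t, 0 ≤ s → s ≤ t → t ≤ 1 →
        0 ≤ ρ.real (Z t) - ρ.real (Z s) ∧ ρ.real (Z t) - ρ.real (Z s) ≤ (t - s) * μ.real A := by
      intro s t hs hst ht
      have : ρ.real (Z t \ Z s) ≤ μ.real (Z t \ Z s) :=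
        ENNReal.toReal_mono (measure_ne_top _ _) (hρ _)
      rw [measureReal_diff (hZm hst) (hZmeas s), measureReal_diff (hZm hst) (hZmeas s),
        hZ t (by linarith) ht μ (Set.mem_insert _ _),
        hZ s hs (by linarith) μ (Set.mem_insert _ _)] at this
      have h2 : ρ.real (Z s) ≤ ρ.real (Z t) := measureReal_mono (hZm hst)
      constructor <;> linarith
    have hcont : ContinuousOn (fun t => ρ.real (Z t)) (Set.Icc 0 1) := by
      have : LipschitzOnWith (μ.real A).toNNReal (fun t => ρ.real (Z t)) (Set.Icc 0 1) := by
        apply LipschitzOnWith.of_dist_le_mul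
        intro x hx y hy
        rw [Real.coe_toNNReal _ measureReal_nonneg, Real.dist_eq, Real.dist_eq]
        rcases le_total x y with h | h
        · have := hlip x y hx.1 h hy.2
          rw [abs_sub_comm, abs_of_nonneg this.1, abs_sub_comm, abs_of_nonneg (by linarith)]
          linarith
        · have := hlip y x hy.1 h hx.2
          rw [abs_of_nonneg this.1, abs_of_nonneg (by linarith)]
          linarith
      exact this.continuousOn
    have hc2 : ContinuousOn (fun t => ρ.real (Z (t + 1/2)) - ρ.real (Z t)) (Set.Icc 0 (1/2)) := by
      apply ContinuousOn.sub
      · refine hcont.comp (f := fun t : ℝ => t + 1/2) (by fun_prop) ?_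
        intro t ht
        constructor <;> linarith [ht.1, ht.2]
      · refine hcont.mono ?_
        intro t ht
        constructor <;> linarith [ht.1, ht.2]
    have key : ∃ t ∈ Set.Icc (0:ℝ) (1/2), ρ.real (Z (t + 1/2)) - ρ.real (Z t) = ρ.real A / 2 := by
      have e0 : (0:ℝ) + 1/2 = 1/2 := by norm_num
      have e1 : (1:ℝ)/2 + 1/2 = 1 := by norm_num
      rcases le_total (ρ.real (Z (1/2))) (ρ.real A / 2) with h | h
      · have := intermediate_value_Icc (by norm_num : (0:ℝ) ≤ 1/2) hc2
        refine this ?_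
        simp only [e0, e1, hZ0, hZ1]
        constructor <;> linarith
      · have := intermediate_value_Icc' (by norm_num : (0:ℝ) ≤ 1/2) hc2
        refine this ?_
        simp only [e0, e1, hZ0, hZ1]
        constructor <;> linarith
    obtain ⟨t, ht, hteq⟩ := key
    have hsub : Z t ⊆ Z (t + 1/2) := hZm (by linarith)
    refine ⟨Z (t + 1/2) \ Z t, Set.diff_subset.trans (hZA _), (hZmeas _).diff (hZmeas _), ?_⟩
    have hgood : ∀ ν ∈ insert μ T, ν.real (Z (t + 1/2) \ Z t) = ν.real A / 2 := by
      intro ν hν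
      haveI := hfin ν hν
      rw [measureReal_diff hsub (hZmeas _), hZ _ (by linarith [ht.1]) (by linarith [ht.2]) ν hν,
        hZ _ ht.1 (by linarith [ht.2]) ν hν]
      ring
    rintro ν (rfl | rfl | hν)
    · exact hgood _ (Set.mem_insert _ _)
    · rw [measureReal_diff hsub (hZmeas _), hteq]
    · exact hgood _ (Set.mem_insert_of_mem _ hν)

/-- Lyapunov-type statement. -/
lemma lyapunov {α ι : Type*} [MeasurableSpace α] [StandardBorelSpace α] [Fintype ι]
    (ν : ι → Measure α) [∀ i, IsFiniteMeasure (ν i)] (h0 : ∀ i x, ν i {x} = 0)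
    (t : ℝ) (ht0 : 0 ≤ t) (ht1 : t ≤ 1) :
    ∃ Z, MeasurableSet Z ∧ ∀ i, (ν i).real Z = t * (ν i).real Set.univ := by
  let μ := ∑ i, ν i
  haveI : IsFiniteMeasure μ := by dsimp [μ]; infer_instance
  haveI : NullSingletonClass μ := ⟨fun x => by simp [μ, h0]⟩
  have hle : ∀ ρ ∈ Set.range ν, ρ ≤ μ := by
    rintro _ ⟨i, rfl⟩
    exact Finset.single_le_sum (f := ν) (fun _ _ => Measure.zero_le _) (Finset.mem_univ i)
  have hfin : ∀ ρ ∈ insert μ (Set.range ν), IsFiniteMeasure ρ := by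
    rintro ρ (rfl | ⟨i, rfl⟩) <;> infer_instance
  obtain ⟨Z, -, hZm, -, hZ⟩ := path_of_half _ hfin
    (half_many μ (Set.range ν) (Set.finite_range ν) hle) Set.univ MeasurableSet.univ
  exact ⟨Z t, hZm t, fun i => hZ t ht0 ht1 _ (Set.mem_insert_of_mem _ ⟨i, rfl⟩)⟩

lemma null_fiber (d : ℕ) (D : Measure ((Fin d → ℝ) × ℝ))
    (condX : ℝ → Measure (Fin d → ℝ))
    (hdisint : D = (D.map Prod.snd).bind fun y => (condX y).map fun x => (x, y))
    (hatomless : ∀ y, Nonatomic (condX y)) (x : Fin d → ℝ) :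
    D (Prod.fst ⁻¹' {x}) = 0 := by
  have hx : ∀ y, condX y {x} = 0 := by
    intro y
    by_contra hne
    obtain ⟨t, hts, -, h1, h2⟩ := hatomless y {x} (measurableSet_singleton x)
      (pos_iff_ne_zero.2 hne)
    rcases Set.subset_singleton_iff_eq.1 hts with rfl | rfl
    · simp at h1
    · exact lt_irrefl _ h2
  have hm : MeasurableSet (Prod.fst ⁻¹' {x} : Set ((Fin d → ℝ) × ℝ)) :=
    measurable_fst (measurableSet_singleton x)
  rw [hdisint]
  refine le_antisymm ((Measure.bind_apply_le _ hm).trans ?_) zero_le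
  have : ∀ y, ((condX y).map fun x => (x, y)) (Prod.fst ⁻¹' {x} : Set ((Fin d → ℝ) × ℝ)) = 0 := by
    intro y
    rw [Measure.map_apply measurable_prodMk_right hm]
    exact hx y
  simp [this]

lemma mix (d k m : ℕ) (B : ℝ)
    (D : Fin (m + 1) → Measure ((Fin d → ℝ) × ℝ))
    [∀ i, IsProbabilityMeasure (D i)]
    (ℓ : Fin (m + 1) → (Fin k → ℝ) → ℝ → ℝ)
    (hℓm : ∀ i, Measurable fun q : (Fin k → ℝ) × ℝ => ℓ i q.1 q.2)
    (hℓb : ∀ i z y, ℓ i z y ∈ Set.Icc (0 : ℝ) B)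
    (hnull : ∀ i x, D i (Prod.fst ⁻¹' {x}) = 0)
    (φ φ' : (Fin d → ℝ) → Fin k → ℝ) (hφ : Measurable φ) (hφ' : Measurable φ')
    (t : ℝ) (ht0 : 0 ≤ t) (ht1 : t ≤ 1) :
    ∃ Z, MeasurableSet Z ∧ ∀ i, expLoss d k (D i) (ℓ i) (Z.piecewise φ φ') =
      t * expLoss d k (D i) (ℓ i) φ + (1 - t) * expLoss d k (D i) (ℓ i) φ' := by
  let Φ : Bool → (Fin d → ℝ) → Fin k → ℝ := fun b => if b then φ else φ'
  have hΦ : ∀ b, Measurable (Φ b) := by intro b; cases b <;> simpa [Φ]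
  let f : Fin (m+1) × Bool → (Fin d → ℝ) × ℝ → ℝ := fun p q => ℓ p.1 (Φ p.2 q.1) q.2
  have hf : ∀ p, Measurable (f p) := fun p =>
    (hℓm p.1).comp (((hΦ p.2).comp measurable_fst).prodMk measurable_snd)
  have hf0 : ∀ p q, 0 ≤ f p q := fun p q => (hℓb _ _ _).1
  have hfi : ∀ p, Integrable (f p) (D p.1) := fun p =>
    Integrable.of_bound (hf p).aestronglyMeasurable B (Filter.Eventually.of_forall fun q => by
      rw [Real.norm_eq_abs, abs_of_nonneg (hf0 p q)]; exact (hℓb _ _ _).2)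
  let ν : Fin (m+1) × Bool → Measure (Fin d → ℝ) := fun p =>
    ((D p.1).withDensity fun q => ENNReal.ofReal (f p q)).map Prod.fst
  have hνf : ∀ p, IsFiniteMeasure (ν p) := by
    intro p
    haveI := isFiniteMeasure_withDensity_ofReal (hfi p).2
    dsimp [ν]; infer_instance
  have hν : ∀ p Z, MeasurableSet Z → (ν p).real Z = ∫ q in Prod.fst ⁻¹' Z, f p q ∂(D p.1) := by
    intro p Z hZ
    rw [integral_eq_lintegral_of_nonneg_ae (Filter.Eventually.of_forall (hf0 p))
      (hf p).aestronglyMeasurable, measureReal_def]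
    simp only [ν]
    rw [Measure.map_apply measurable_fst hZ, withDensity_apply _ (measurable_fst hZ)]
  have hν0 : ∀ p x, ν p {x} = 0 := by
    intro p x
    simp only [ν]
    rw [Measure.map_apply measurable_fst (measurableSet_singleton x)]
    exact withDensity_absolutelyContinuous _ _ (hnull p.1 x)
  obtain ⟨Z, hZ, hZe⟩ := lyapunov ν hν0 t ht0 ht1
  refine ⟨Z, hZ, fun i => ?_⟩
  have hfst : MeasurableSet (Prod.fst ⁻¹' Z : Set ((Fin d → ℝ) × ℝ)) := measurable_fst hZ
  have e1 := hZe (i, true)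
  have e2 := hZe (i, false)
  rw [hν _ _ hZ, hν _ _ MeasurableSet.univ, Set.preimage_univ, setIntegral_univ] at e1 e2
  have e3 := integral_add_compl hfst (hfi (i, false))
  have hpw : ∀ q, ℓ i (Z.piecewise φ φ' q.1) q.2 =
      (Prod.fst ⁻¹' Z).piecewise (f (i, true)) (f (i, false)) q := by
    intro q
    by_cases hq : q.1 ∈ Z
    · rw [Set.piecewise_eq_of_mem _ _ _ hq, Set.piecewise_eq_of_mem _ _ _ (by exact hq)]; simp [f, Φ]
    · rw [Set.piecewise_eq_of_notMem _ _ _ hq, Set.piecewise_eq_of_notMem _ _ _ (by exact hq)]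
      simp [f, Φ]
  have g1 : expLoss d k (D i) (ℓ i) φ = ∫ q, f (i, true) q ∂(D i) := by simp [expLoss, f, Φ]
  have g2 : expLoss d k (D i) (ℓ i) φ' = ∫ q, f (i, false) q ∂(D i) := by simp [expLoss, f, Φ]
  rw [g1, g2]
  unfold expLoss
  simp_rw [hpw]
  rw [integral_piecewise hfst (hfi (i, true)).integrableOn (hfi (i, false)).integrableOn]
  dsimp only at e1 e2 e3
  linarith

/-- **Convexity of the cost-constraints epigraph set (classification case).**
Suppose `Y` is finite, for each `i = 0,…,m` and each `y` the conditional distribution of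
`x` given `y` under `D_i` is non-atomic, and `H̄` is nonempty and decomposable.  Then
`C = {(s₀,s) : ∃ φ ∈ H̄, E_{D_0}[ℓ_0(φ(x),y)] ≤ s₀ ∧ ∀ i, E_{D_i}[ℓ_i(φ(x),y)] ≤ s_i}`
is a nonempty convex set. -/
theorem cost_constraints_epigraph_convex
    (d k m : ℕ) (B : ℝ) (hB : 0 < B)
    (D : Fin (m + 1) → Measure ((Fin d → ℝ) × ℝ))
    [∀ i, IsProbabilityMeasure (D i)]
    (ℓ : Fin (m + 1) → (Fin k → ℝ) → ℝ → ℝ)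
    (hℓm : ∀ i, Measurable fun q : (Fin k → ℝ) × ℝ => ℓ i q.1 q.2)
    (hℓb : ∀ i z y, ℓ i z y ∈ Set.Icc (0 : ℝ) B)
    -- H̄ is a nonempty set of measurable functions
    (Hbar : Set ((Fin d → ℝ) → Fin k → ℝ))
    (hHne : Hbar.Nonempty)
    (hHmeas : ∀ φ ∈ Hbar, Measurable φ)
    -- H̄ is decomposable
    (hHdec : ∀ φ ∈ Hbar, ∀ φ' ∈ Hbar, ∀ Z : Set (Fin d → ℝ), MeasurableSet Z →
      Z.piecewise φ φ' ∈ Hbar)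
    -- Y is finite and supports the label marginals
    (Yset : Set ℝ) (hYfin : Yset.Finite)
    (hYsupp : ∀ i, D i {q | q.2 ∉ Yset} = 0)
    -- conditional distributions of x given y, non-atomic for every y
    (condX : Fin (m + 1) → ℝ → Measure (Fin d → ℝ))
    (hdisint : ∀ i, D i =
      ((D i).map Prod.snd).bind fun y => (condX i y).map fun x => (x, y))
    (hatomless : ∀ i y, Nonatomic (condX i y)) :
    ({q : ℝ × (Fin m → ℝ) | ∃ φ ∈ Hbar,
        expLoss d k (D 0) (ℓ 0) φ ≤ q.1 ∧
        ∀ i : Fin m, expLoss d k (D i.succ) (ℓ i.succ) φ ≤ q.2 i}).Nonempty ∧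
    Convex ℝ {q : ℝ × (Fin m → ℝ) | ∃ φ ∈ Hbar,
        expLoss d k (D 0) (ℓ 0) φ ≤ q.1 ∧
        ∀ i : Fin m, expLoss d k (D i.succ) (ℓ i.succ) φ ≤ q.2 i} := by
  have hnull : ∀ i x, D i (Prod.fst ⁻¹' {x}) = 0 := fun i x =>
    null_fiber d (D i) (condX i) (hdisint i) (hatomless i) x
  constructor
  · obtain ⟨φ, hφ⟩ := hHne
    exact ⟨(expLoss d k (D 0) (ℓ 0) φ, fun i => expLoss d k (D i.succ) (ℓ i.succ) φ),
      φ, hφ, le_rfl, fun i => le_rfl⟩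
  · rintro p ⟨φ, hφ, hp0, hp⟩ q ⟨φ', hφ', hq0, hq⟩ a b ha hb hab
    obtain ⟨Z, hZ, hZe⟩ := mix d k m B D ℓ hℓm hℓb hnull φ φ' (hHmeas φ hφ) (hHmeas φ' hφ') a ha
      (by linarith)
    obtain rfl : b = 1 - a := by linarith
    refine ⟨Z.piecewise φ φ', hHdec φ hφ φ' hφ' Z hZ, ?_, fun i => ?_⟩
    · have := hZe 0
      have h1 := mul_le_mul_of_nonneg_left hp0 ha
      have h2 := mul_le_mul_of_nonneg_left hq0 hb
      simp only [Prod.fst_add, Prod.smul_fst, smul_eq_mul]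
      convert! add_le_add h1 h2 using 1
    · have := hZe i.succ
      have h1 := mul_le_mul_of_nonneg_left (hp i) ha
      have h2 := mul_le_mul_of_nonneg_left (hq i) hb
      simp only [Prod.snd_add, Prod.smul_snd, Pi.add_apply, Pi.smul_apply, smul_eq_mul]
      convert! add_le_add h1 h2 using 1

end CSL4
end

section
/- Under the margin assumption with margin τ > 0, for every μ ∈ ℝ^m with μ ≥ 0 and every minimizer θ_σ†(μ) ∈ argmin_{θ∈Θ} L̂_σ(θ,μ) of the surrogate Lagrangian, the rate-constrained Lagrangian satisfies L̂_R(θ_σ†(μ), μ) ≤ min_{θ∈Θ} L̂_R(θ,μ) + 2‖μ‖₁ (1 − σ(τ)). -/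
open Finset

namespace CSL12

/-- The sigmoid surrogate `σ(x) = (1 + e^{−ax})⁻¹`. -/
noncomputable def sigm (a x : ℝ) : ℝ := (1 + Real.exp (-a * x))⁻¹

/-- Rate-constrained empirical Lagrangian `L̂_R(θ,μ)`, built from indicator functions. -/
noncomputable def LagR (d p k m : ℕ)
    (f : (Fin p → ℝ) → (Fin d → ℝ) → Fin k → ℝ)
    (ℓ0 : (Fin k → ℝ) → ℝ → ℝ)
    (g : Fin m → (Fin k → ℝ) → ℝ → ℝ)
    (c : Fin m → ℝ)
    (N : Fin (m + 1) → ℕ)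
    (xs : ∀ i : Fin (m + 1), Fin (N i) → (Fin d → ℝ) × ℝ)
    (θ : Fin p → ℝ) (μ : Fin m → ℝ) : ℝ :=
  (N 0 : ℝ)⁻¹ * ∑ n : Fin (N 0), ℓ0 (f θ (xs 0 n).1) (xs 0 n).2
    + ∑ i : Fin m, μ i *
        ((N i.succ : ℝ)⁻¹ * ∑ n : Fin (N i.succ),
          (if 0 ≤ g i (f θ (xs i.succ n).1) (xs i.succ n).2 then (1 : ℝ) else 0) - c i)

/-- Surrogate empirical Lagrangian `L̂_σ(θ,μ)`, with the indicators replaced by sigmoids. -/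
noncomputable def LagSig (d p k m : ℕ) (a : ℝ)
    (f : (Fin p → ℝ) → (Fin d → ℝ) → Fin k → ℝ)
    (ℓ0 : (Fin k → ℝ) → ℝ → ℝ)
    (g : Fin m → (Fin k → ℝ) → ℝ → ℝ)
    (c : Fin m → ℝ)
    (N : Fin (m + 1) → ℕ)
    (xs : ∀ i : Fin (m + 1), Fin (N i) → (Fin d → ℝ) × ℝ)
    (θ : Fin p → ℝ) (μ : Fin m → ℝ) : ℝ :=
  (N 0 : ℝ)⁻¹ * ∑ n : Fin (N 0), ℓ0 (f θ (xs 0 n).1) (xs 0 n).2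
    + ∑ i : Fin m, μ i *
        ((N i.succ : ℝ)⁻¹ * ∑ n : Fin (N i.succ),
          sigm a (g i (f θ (xs i.succ n).1) (xs i.succ n).2) - c i)

theorem sigm_mono {a x y : ℝ} (ha : 1 ≤ a) (h : x ≤ y) : sigm a x ≤ sigm a y := by
  unfold sigm
  apply inv_anti₀ (by positivity)
  have : Real.exp (-a * y) ≤ Real.exp (-a * x) := Real.exp_le_exp.mpr (by nlinarith)
  linarith

theorem sigm_neg (a x : ℝ) : sigm a (-x) = 1 - sigm a x := by
  unfold sigm
  have h : Real.exp (-a * -x) = (Real.exp (-a * x))⁻¹ := by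
    rw [← Real.exp_neg]; congr 1; ring
  rw [h]
  have := Real.exp_pos (-a * x)
  field_simp
  ring

theorem sigm_pos (a x : ℝ) : 0 < sigm a x := by
  unfold sigm; positivity

theorem ind_bound {a τ x : ℝ} (ha : 1 ≤ a) (hτ : 0 < τ) (h : τ ≤ |x|) :
    |(if 0 ≤ x then (1 : ℝ) else 0) - sigm a x| ≤ 1 - sigm a τ := by
  have h1 := sigm_pos a x
  have h2 := sigm_pos a (-x)
  have h3 := sigm_neg a x
  split_ifs with hx
  · rw [abs_of_nonneg hx] at h
    have := sigm_mono ha h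
    rw [abs_le]; constructor <;> linarith
  · rw [abs_of_neg (not_le.mp hx)] at h
    have := sigm_mono ha h
    rw [abs_le]; constructor <;> linarith

theorem lag_bound (d p k m : ℕ) (a τ : ℝ) (ha : 1 ≤ a) (hτ : 0 < τ)
    (f : (Fin p → ℝ) → (Fin d → ℝ) → Fin k → ℝ)
    (ℓ0 : (Fin k → ℝ) → ℝ → ℝ)
    (g : Fin m → (Fin k → ℝ) → ℝ → ℝ)
    (c : Fin m → ℝ)
    (N : Fin (m + 1) → ℕ) (hN : ∀ i, 0 < N i)
    (xs : ∀ i : Fin (m + 1), Fin (N i) → (Fin d → ℝ) × ℝ)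
    (θ : Fin p → ℝ) (μ : Fin m → ℝ)
    (h : ∀ (i : Fin m) (n : Fin (N i.succ)),
        τ ≤ |g i (f θ (xs i.succ n).1) (xs i.succ n).2|) :
    |LagR d p k m f ℓ0 g c N xs θ μ - LagSig d p k m a f ℓ0 g c N xs θ μ|
      ≤ (∑ i : Fin m, |μ i|) * (1 - sigm a τ) := by
  unfold LagR LagSig
  rw [add_sub_add_left_eq_sub, ← Finset.sum_sub_distrib, Finset.sum_mul]
  refine (Finset.abs_sum_le_sum_abs _ _).trans (Finset.sum_le_sum fun i _ => ?_)
  rw [← mul_sub, sub_sub_sub_cancel_right, ← mul_sub, ← Finset.sum_sub_distrib, abs_mul]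
  refine mul_le_mul_of_nonneg_left ?_ (abs_nonneg _)
  have hn : (0 : ℝ) < N i.succ := by exact_mod_cast hN i.succ
  rw [abs_mul, abs_of_pos (inv_pos.mpr hn), inv_mul_le_iff₀ hn]
  refine (Finset.abs_sum_le_sum_abs _ _).trans ?_
  refine (Finset.sum_le_sum fun n _ => ind_bound ha hτ (h i n)).trans ?_
  rw [Finset.sum_const, Finset.card_univ, Fintype.card_fin, nsmul_eq_mul]

/-- **Surrogate minimizers approximately minimize the rate-constrained Lagrangian.**
Under the margin assumption with margin `τ > 0`, for every `μ ≥ 0` and every minimizer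
`θ_σ†(μ)` of the surrogate Lagrangian `L̂_σ(·,μ)`,
`L̂_R(θ_σ†(μ), μ) ≤ min_θ L̂_R(θ,μ) + 2‖μ‖₁ (1 − σ(τ))`. -/
theorem surrogate_rate_constrained_approx
    (d p k m : ℕ) (B a τ : ℝ) (hB : 0 < B) (ha : 1 ≤ a) (hτ : 0 < τ)
    (Θ : Set (Fin p → ℝ)) (hΘc : IsCompact Θ) (hΘne : Θ.Nonempty)
    (f : (Fin p → ℝ) → (Fin d → ℝ) → Fin k → ℝ)
    (ℓ0 : (Fin k → ℝ) → ℝ → ℝ)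
    (hℓ0 : ∀ z y, ℓ0 z y ∈ Set.Icc (0 : ℝ) B)
    (g : Fin m → (Fin k → ℝ) → ℝ → ℝ)
    (c : Fin m → ℝ)
    (N : Fin (m + 1) → ℕ) (hN : ∀ i, 0 < N i)
    (xs : ∀ i : Fin (m + 1), Fin (N i) → (Fin d → ℝ) × ℝ)
    -- the minima of both Lagrangians over Θ are attained for every μ ≥ 0
    (hattR : ∀ μ : Fin m → ℝ, 0 ≤ μ → ∃ θ ∈ Θ, ∀ θ' ∈ Θ,
      LagR d p k m f ℓ0 g c N xs θ μ ≤ LagR d p k m f ℓ0 g c N xs θ' μ)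
    (hattS : ∀ μ : Fin m → ℝ, 0 ≤ μ → ∃ θ ∈ Θ, ∀ θ' ∈ Θ,
      LagSig d p k m a f ℓ0 g c N xs θ μ ≤ LagSig d p k m a f ℓ0 g c N xs θ' μ)
    -- margin assumption: every minimizer of either Lagrangian has margin at least τ
    (hmargin : ∀ μ : Fin m → ℝ, 0 ≤ μ → ∀ θ ∈ Θ,
      ((∀ θ' ∈ Θ, LagR d p k m f ℓ0 g c N xs θ μ ≤ LagR d p k m f ℓ0 g c N xs θ' μ) ∨
        (∀ θ' ∈ Θ, LagSig d p k m a f ℓ0 g c N xs θ μ ≤ LagSig d p k m a f ℓ0 g c N xs θ' μ)) →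
      ∀ (i : Fin m) (n : Fin (N i.succ)),
        τ ≤ |g i (f θ (xs i.succ n).1) (xs i.succ n).2|) :
    ∀ μ : Fin m → ℝ, 0 ≤ μ → ∀ θσ ∈ Θ,
      (∀ θ' ∈ Θ, LagSig d p k m a f ℓ0 g c N xs θσ μ ≤ LagSig d p k m a f ℓ0 g c N xs θ' μ) →
      LagR d p k m f ℓ0 g c N xs θσ μ
        ≤ sInf {r : ℝ | ∃ θ ∈ Θ, r = LagR d p k m f ℓ0 g c N xs θ μ}
          + 2 * (∑ i : Fin m, |μ i|) * (1 - sigm a τ) := by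
  intro μ hμ θσ hθσ hmin
  obtain ⟨θR, hθR, hR⟩ := hattR μ hμ
  have e : LagR d p k m f ℓ0 g c N xs θR μ
      ≤ sInf {r : ℝ | ∃ θ ∈ Θ, r = LagR d p k m f ℓ0 g c N xs θ μ} := by
    refine le_csInf ⟨_, θR, hθR, rfl⟩ ?_
    rintro r ⟨θ, hθ, rfl⟩
    exact hR θ hθ
  have b1 := abs_le.mp (lag_bound d p k m a τ ha hτ f ℓ0 g c N hN xs θR μ
    (hmargin μ hμ θR hθR (Or.inl hR)))
  have b2 := abs_le.mp (lag_bound d p k m a τ ha hτ f ℓ0 g c N hN xs θσ μ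
    (hmargin μ hμ θσ hθσ (Or.inr hmin)))
  have b3 := hmin θR hθR
  linarith [b1.1, b2.2]

end CSL12
end

section
/- Let {μ^(t)} be the sequence of dual variables generated by the dual-ascent algorithm and let M* = argmax_{μ≥0} d̂(μ) be the (nonempty) set of maximizers of the empirical dual function. Under the empirical strict feasibility assumption (there is θ̂′ ∈ Θ and ξ > 0 with (1/N_i) Σ_n ℓ_i(f_{θ̂′}(x_n),y_n) ≤ c_i − ξ for all i = 1,…,m), with losses valued in [0,B] and c_i ∈ [0,B], there exists a constant C < ∞ such that inf_{μ*∈M*} ‖μ^(t) − μ*‖ ≤ C for all t ≥ 0. -/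
open Finset

namespace CSL15

/-- Empirical average of a loss over a finite sample. -/
noncomputable def empLoss (d k : ℕ) {N : ℕ} (xs : Fin N → (Fin d → ℝ) × ℝ)
    (ℓ : (Fin k → ℝ) → ℝ → ℝ) (g : (Fin d → ℝ) → Fin k → ℝ) : ℝ :=
  (N : ℝ)⁻¹ * ∑ n : Fin N, ℓ (g (xs n).1) (xs n).2

/-- Empirical Lagrangian `L̂(θ,μ)`. -/
noncomputable def LagE (d p k m : ℕ) (N : Fin (m + 1) → ℕ)
    (xs : ∀ i : Fin (m + 1), Fin (N i) → (Fin d → ℝ) × ℝ)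
    (f : (Fin p → ℝ) → (Fin d → ℝ) → Fin k → ℝ)
    (ℓ : Fin (m + 1) → (Fin k → ℝ) → ℝ → ℝ) (c : Fin m → ℝ)
    (θ : Fin p → ℝ) (μ : Fin m → ℝ) : ℝ :=
  empLoss d k (xs 0) (ℓ 0) (f θ)
    + ∑ i : Fin m, μ i * (empLoss d k (xs i.succ) (ℓ i.succ) (f θ) - c i)

/-- Empirical dual function `d̂(μ) = min_{θ∈Θ} L̂(θ,μ)`. -/
noncomputable def dE (d p k m : ℕ) (N : Fin (m + 1) → ℕ)
    (xs : ∀ i : Fin (m + 1), Fin (N i) → (Fin d → ℝ) × ℝ)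
    (Θ : Set (Fin p → ℝ))
    (f : (Fin p → ℝ) → (Fin d → ℝ) → Fin k → ℝ)
    (ℓ : Fin (m + 1) → (Fin k → ℝ) → ℝ → ℝ) (c : Fin m → ℝ)
    (μ : Fin m → ℝ) : ℝ :=
  sInf {r : ℝ | ∃ θ ∈ Θ, r = LagE d p k m N xs f ℓ c θ μ}

theorem empLoss_mem (d k : ℕ) {N : ℕ} (hN : 0 < N) (xs : Fin N → (Fin d → ℝ) × ℝ)
    (ℓ : (Fin k → ℝ) → ℝ → ℝ) (g : (Fin d → ℝ) → Fin k → ℝ) (B : ℝ)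
    (h : ∀ z y, ℓ z y ∈ Set.Icc (0 : ℝ) B) :
    0 ≤ empLoss d k xs ℓ g ∧ empLoss d k xs ℓ g ≤ B := by
  have hN' : (0 : ℝ) < N := by exact_mod_cast hN
  unfold empLoss
  refine ⟨mul_nonneg (by positivity) (Finset.sum_nonneg fun n _ => (h _ _).1), ?_⟩
  have h1 : ∑ n : Fin N, ℓ (g (xs n).1) (xs n).2 ≤ ∑ n : Fin N, B :=
    Finset.sum_le_sum fun n _ => (h _ _).2
  rw [Finset.sum_const, Finset.card_univ, Fintype.card_fin, nsmul_eq_mul] at h1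
  rw [inv_mul_le_iff₀ hN']
  exact h1

/-- **The dual-ascent iterates stay within bounded distance of the dual maximizers.**
Let `{μ^(t)}` be generated by the dual-ascent algorithm and `M* = argmax_{μ≥0} d̂(μ)` be
nonempty.  Under empirical strict feasibility (some `θ̂′ ∈ Θ`, `ξ > 0` with all empirical
constraint values at most `c_i − ξ`), losses in `[0,B]` and `c_i ∈ [0,B]`, there is a
constant `C < ∞` with `inf_{μ*∈M*} ‖μ^(t) − μ*‖ ≤ C` for all `t ≥ 0`. -/
theorem dual_iterates_bounded
    (d p k m : ℕ) (B η ρ ξ : ℝ) (hB : 0 < B) (hη : 0 < η) (hρ : 0 ≤ ρ) (hξ : 0 < ξ)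
    (Θ : Set (Fin p → ℝ)) (hΘc : IsCompact Θ) (hΘne : Θ.Nonempty)
    (f : (Fin p → ℝ) → (Fin d → ℝ) → Fin k → ℝ)
    (hfc : ∀ x : Fin d → ℝ, ContinuousOn (fun θ => f θ x) Θ)
    (ℓ : Fin (m + 1) → (Fin k → ℝ) → ℝ → ℝ)
    (hℓb : ∀ i z y, ℓ i z y ∈ Set.Icc (0 : ℝ) B)
    (c : Fin m → ℝ) (hc : ∀ i, c i ∈ Set.Icc (0 : ℝ) B)
    (N : Fin (m + 1) → ℕ) (hN : ∀ i, 0 < N i)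
    (xs : ∀ i : Fin (m + 1), Fin (N i) → (Fin d → ℝ) × ℝ)
    -- empirical strict feasibility
    (hfeas : ∃ θ' ∈ Θ, ∀ i : Fin m,
      empLoss d k (xs i.succ) (ℓ i.succ) (f θ') ≤ c i - ξ)
    -- the set of maximizers of the empirical dual function is nonempty
    (hMne : {μ : Fin m → ℝ | 0 ≤ μ ∧ ∀ μ' : Fin m → ℝ, 0 ≤ μ' →
      dE d p k m N xs Θ f ℓ c μ' ≤ dE d p k m N xs Θ f ℓ c μ}.Nonempty)
    -- dual-ascent iterates
    (θseq : ℕ → Fin p → ℝ) (μseq : ℕ → Fin m → ℝ)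
    (hθΘ : ∀ t, θseq t ∈ Θ)
    (hμ0 : μseq 0 = 0)
    (happrox : ∀ t, LagE d p k m N xs f ℓ c (θseq t) (μseq t)
      ≤ dE d p k m N xs Θ f ℓ c (μseq t) + ρ)
    (hupd : ∀ (t : ℕ) (i : Fin m), μseq (t + 1) i =
      max (μseq t i + η * (empLoss d k (xs i.succ) (ℓ i.succ) (f (θseq t)) - c i)) 0) :
    ∃ C : ℝ, ∀ t : ℕ,
      sInf {r : ℝ | ∃ μ' ∈ {μ : Fin m → ℝ | 0 ≤ μ ∧ ∀ μ'' : Fin m → ℝ, 0 ≤ μ'' →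
          dE d p k m N xs Θ f ℓ c μ'' ≤ dE d p k m N xs Θ f ℓ c μ},
        r = Real.sqrt (∑ i : Fin m, (μseq t i - μ' i) ^ 2)} ≤ C := by
  obtain ⟨θ', hθ', hfe⟩ := hfeas
  obtain ⟨μs, hμs⟩ := hMne
  have hE : ∀ i θ, 0 ≤ empLoss d k (xs i) (ℓ i) (f θ) ∧ empLoss d k (xs i) (ℓ i) (f θ) ≤ B :=
    fun i θ => empLoss_mem d k (hN i) (xs i) (ℓ i) (f θ) B (hℓb i)
  have hs : ∀ (i : Fin m) θ, |empLoss d k (xs i.succ) (ℓ i.succ) (f θ) - c i| ≤ B := by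
    intro i θ
    have h1 := hE i.succ θ
    have h2 := hc i
    rw [abs_le]
    constructor <;> linarith [h1.1, h1.2, h2.1, h2.2]
  have hpos : ∀ t i, 0 ≤ μseq t i := by
    intro t i
    cases t with
    | zero => simp [hμ0]
    | succ t => rw [hupd]; exact le_max_right _ _
  have hdE : ∀ t, dE d p k m N xs Θ f ℓ c (μseq t) ≤ LagE d p k m N xs f ℓ c θ' (μseq t) := by
    intro t
    refine csInf_le ⟨-∑ i, μseq t i * B, ?_⟩ ⟨θ', hθ', rfl⟩
    rintro r ⟨θ, _, rfl⟩
    unfold LagE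
    rw [← Finset.sum_neg_distrib]
    have : ∑ i, -(μseq t i * B) ≤
        ∑ i, μseq t i * (empLoss d k (xs i.succ) (ℓ i.succ) (f θ) - c i) := by
      refine Finset.sum_le_sum fun i _ => ?_
      have := mul_le_mul_of_nonneg_left (abs_le.1 (hs i θ)).1 (hpos t i)
      linarith
    linarith [(hE 0 θ).1]
  have hdrift : ∀ t, ∑ i, μseq t i * (empLoss d k (xs i.succ) (ℓ i.succ) (f (θseq t)) - c i)
      ≤ B + ρ - ξ * ∑ i, μseq t i := by
    intro t
    have h1 := (happrox t).trans (add_le_add_left (hdE t) ρ)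
    unfold LagE at h1
    have h2 : ∑ i, μseq t i * (empLoss d k (xs i.succ) (ℓ i.succ) (f θ') - c i)
        ≤ ∑ i, -(ξ * μseq t i) := by
      refine Finset.sum_le_sum fun i _ => ?_
      have := mul_le_mul_of_nonneg_left (hfe i) (hpos t i)
      linarith
    rw [Finset.sum_neg_distrib, ← Finset.mul_sum] at h2
    linarith [(hE 0 θ').2, (hE 0 (θseq t)).1]
  obtain ⟨A, hA⟩ : ∃ A : ℝ, A = 2 * η * (B + ρ) + m * (η ^ 2 * B ^ 2) := ⟨_, rfl⟩
  have hA0 : 0 ≤ A := by rw [hA]; positivity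
  have hstep : ∀ t, ∑ i, μseq (t + 1) i ^ 2 ≤
      ∑ i, μseq t i ^ 2 + A - 2 * η * ξ * ∑ i, μseq t i := by
    intro t
    have h1 : ∑ i, μseq (t + 1) i ^ 2 ≤ ∑ i, (μseq t i ^ 2
        + 2 * η * (μseq t i * (empLoss d k (xs i.succ) (ℓ i.succ) (f (θseq t)) - c i))
        + η ^ 2 * B ^ 2) := by
      refine Finset.sum_le_sum fun i _ => ?_
      rw [hupd]
      have h2 := sq_le_sq' (abs_le.1 (hs i (θseq t))).1 (abs_le.1 (hs i (θseq t))).2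
      generalize empLoss d k (xs i.succ) (ℓ i.succ) (f (θseq t)) - c i = s at h2 ⊢
      have h3 : (max (μseq t i + η * s) 0) ^ 2 ≤ (μseq t i + η * s) ^ 2 := by
        rcases max_cases (μseq t i + η * s) 0 with ⟨h, _⟩ | ⟨h, _⟩ <;> rw [h]
        rw [zero_pow two_ne_zero]
        exact sq_nonneg _
      have h4 := mul_le_mul_of_nonneg_left h2 (sq_nonneg η)
      linarith
    rw [Finset.sum_add_distrib, Finset.sum_add_distrib, ← Finset.mul_sum, Finset.sum_const,
      Finset.card_univ, Fintype.card_fin, nsmul_eq_mul] at h1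
    have h5 := mul_le_mul_of_nonneg_left (hdrift t) (by positivity : 0 ≤ 2 * η)
    rw [hA]
    linarith
  obtain ⟨R, hR⟩ : ∃ R : ℝ, R = A / (2 * η * ξ) := ⟨_, rfl⟩
  have hRA : 2 * η * ξ * R = A := by rw [hR]; field_simp
  have hV : ∀ t, ∑ i, μseq t i ^ 2 ≤ R ^ 2 + A := by
    intro t
    induction t with
    | zero => simp only [hμ0, Pi.zero_apply]; simp; positivity
    | succ t ih =>
      have h1 := hstep t
      have hS : 0 ≤ ∑ i, μseq t i := Finset.sum_nonneg fun i _ => hpos t i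
      have hk : 0 < 2 * η * ξ := by positivity
      rcases le_total R (∑ i, μseq t i) with h | h
      · have := mul_le_mul_of_nonneg_left h hk.le
        linarith
      · have h2 : ∑ i, μseq t i ^ 2 ≤ (∑ i, μseq t i) ^ 2 :=
          Finset.sum_sq_le_sq_sum_of_nonneg fun i _ => hpos t i
        have h3 : (∑ i, μseq t i) ^ 2 ≤ R ^ 2 := pow_le_pow_left₀ hS h 2
        have := mul_nonneg hk.le hS
        linarith
  refine ⟨Real.sqrt (2 * (R ^ 2 + A) + 2 * ∑ i, μs i ^ 2), fun t => ?_⟩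
  refine le_trans (b := Real.sqrt (∑ i, (μseq t i - μs i) ^ 2))
    (csInf_le ⟨0, ?_⟩ ⟨μs, hμs, rfl⟩) (Real.sqrt_le_sqrt ?_)
  · rintro r ⟨_, _, rfl⟩
    exact Real.sqrt_nonneg _
  · have h1 : ∑ i, (μseq t i - μs i) ^ 2 ≤ ∑ i, (2 * μseq t i ^ 2 + 2 * μs i ^ 2) :=
      Finset.sum_le_sum fun i _ => by nlinarith [sq_nonneg (μseq t i + μs i)]
    rw [Finset.sum_add_distrib, ← Finset.mul_sum, ← Finset.mul_sum] at h1
    linarith [hV t]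

end CSL15
end

section
/- Let η > 0, B > 0, and let s^(t) ∈ ℝ^m be vectors with ‖s^(t)‖² ≤ m B² for all t ≥ 0. Define μ^(0) = 0 and μ_i^(t) = max(μ_i^(t−1) + η s_i^(t−1), 0) componentwise for t ≥ 1. Then for every T ≥ 1, the ergodic complementary slackness satisfies (1/T) Σ_{t=0}^{T−1} Σ_{i=1}^m μ_i^(t) s_i^(t) ≥ −η m B²/2. -/
open Finset

/-- **Ergodic complementary slackness along projected dual ascent.**
Let `η > 0`, `B > 0`, and let `s^(t) ∈ ℝ^m` be vectors with `‖s^(t)‖² ≤ m B²` for all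
`t ≥ 0`.  Define `μ^(0) = 0` and `μ_i^(t) = max(μ_i^(t−1) + η s_i^(t−1), 0)` componentwise.
Then for every `T ≥ 1`,
`(1/T) Σ_{t=0}^{T−1} Σ_{i=1}^m μ_i^(t) s_i^(t) ≥ −η m B²/2`. -/
theorem ergodic_complementary_slackness
    (m : ℕ) (η B : ℝ) (hη : 0 < η) (hB : 0 < B)
    (s : ℕ → Fin m → ℝ)
    (hs : ∀ t : ℕ, ∑ i : Fin m, (s t i) ^ 2 ≤ (m : ℝ) * B ^ 2)
    (μ : ℕ → Fin m → ℝ)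
    (hμ0 : μ 0 = 0)
    (hrec : ∀ (t : ℕ) (i : Fin m), μ (t + 1) i = max (μ t i + η * s t i) 0)
    (T : ℕ) (hT : 1 ≤ T) :
    -(η * (m : ℝ) * B ^ 2 / 2) ≤
      (T : ℝ)⁻¹ * ∑ t ∈ Finset.range T, ∑ i : Fin m, μ t i * s t i := by
  have key : ∀ n : ℕ, ∑ i : Fin m, (μ n i) ^ 2 ≤
      2 * η * (∑ t ∈ Finset.range n, ∑ i : Fin m, μ t i * s t i)
        + η ^ 2 * (n * ((m : ℝ) * B ^ 2)) := by
    intro n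
    induction n with
    | zero => simp [hμ0]
    | succ n ih =>
      have h1 : ∑ i : Fin m, (μ (n + 1) i) ^ 2 ≤
          ∑ i : Fin m, ((μ n i) ^ 2 + 2 * η * (μ n i * s n i) + η ^ 2 * (s n i) ^ 2) := by
        apply Finset.sum_le_sum
        intro i _
        rw [hrec]
        rcases max_cases (μ n i + η * s n i) 0 with ⟨h, _⟩ | ⟨h, _⟩ <;> rw [h] <;>
          nlinarith [sq_nonneg (μ n i + η * s n i)]
      rw [Finset.sum_add_distrib, Finset.sum_add_distrib, ← Finset.mul_sum,
        ← Finset.mul_sum] at h1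
      have h2 := mul_le_mul_of_nonneg_left (hs n) (sq_nonneg η)
      rw [Finset.sum_range_succ]
      push_cast
      linarith
  have hk := key T
  have h0 : 0 ≤ ∑ i : Fin m, (μ T i) ^ 2 := Finset.sum_nonneg fun i _ => sq_nonneg _
  have hTp : (0 : ℝ) < T := by exact_mod_cast hT
  rw [inv_mul_eq_div, le_div_iff₀ hTp]
  refine le_of_mul_le_mul_left ?_ (by positivity : 0 < 2 * η)
  linarith
end
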